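/- Let P be a submonoid of a group G and let p₁, q₁, …, p_n, q_n ∈ P. Then the bounded operator W = V_{p₁}* V_{q₁} ⋯ V_{p_n}* V_{q_n} on ℓ²(P) is a partial isometry: W W* W = W. -/

import Mathlib

noncomputable section

open ContinuousLinearMap
open scoped Classical

variable {G : Type*} [Group G]

/-- The Hilbert space ℓ²(P). -/
abbrev l2 (P : Submonoid G) : Type _ := lp (fun _ : P => ℂ) 2

/-- The standard orthonormal basis vector δ_s of ℓ²(P). -/
def delta (P : Submonoid G) (s : P) : l2 P :=
  letI := Classical.decEq P
  lp.single 2 s 1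

/-- The set pX = {px : x ∈ X}. -/
def lmul (P : Submonoid G) (p : P) (X : Set P) : Set P := (fun x => p * x) '' X

/-- The set p⁻¹X = {y ∈ P : py ∈ X}. -/
def linv (P : Submonoid G) (p : P) (X : Set P) : Set P := {y : P | p * y ∈ X}

/-- The set p₁⁻¹q₁ ⋯ pₙ⁻¹qₙ X, the operations being applied iteratively from the right;
the word is encoded as the list [(p₁,q₁),…,(pₙ,qₙ)]. -/
def wordSet (P : Submonoid G) (l : List (P × P)) (X : Set P) : Set P :=
  l.foldr (fun a Y => linv P a.1 (lmul P a.2 Y)) X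

/-- The operator V_{p₁}* V_{q₁} ⋯ V_{pₙ}* V_{qₙ} on ℓ²(P), the word being encoded as the
list [(p₁,q₁),…,(pₙ,qₙ)]. -/
def opWord (P : Submonoid G) (V : P → (l2 P →L[ℂ] l2 P)) (l : List (P × P)) :
    l2 P →L[ℂ] l2 P :=
  (l.map fun a => (ContinuousLinearMap.adjoint (V a.1)) * (V a.2)).prod

/-- The group element p₁⁻¹q₁ ⋯ pₙ⁻¹qₙ of G. -/
def grpWord (P : Submonoid G) (l : List (P × P)) : G :=
  (l.map fun a => ((a.1 : G))⁻¹ * (a.2 : G)).prod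


/-- The value at `t` of a vector of ℓ²(P) is its inner product with `δ_t`. -/
theorem inner_delta_left (P : Submonoid G) (t : P) (x : l2 P) :
    inner ℂ (delta P t) x = x t := by
  simp [delta, lp.inner_single_left]

theorem delta_apply_self (P : Submonoid G) (t : P) : delta P t t = 1 := by
  simp [delta]

theorem delta_apply_of_ne (P : Submonoid G) {s t : P} (h : t ≠ s) : delta P s t = 0 := by
  simp [delta, h]

theorem ext_delta (P : Submonoid G) {S T : l2 P →L[ℂ] l2 P}
    (h : ∀ s, S (delta P s) = T (delta P s)) : S = T := by
  let := Classical.decEq P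
  refine lp.ext_continuousLinearMap (by simp) fun s => ContinuousLinearMap.ext_ring ?_
  exact h s

/-- The value of `T* δ_t` at `s` is the conjugate of the value of `T δ_s` at `t`. -/
theorem adjoint_delta_apply (P : Submonoid G) (T : l2 P →L[ℂ] l2 P) (s t : P) :
    adjoint T (delta P t) s = star (T (delta P s) t) := by
  rw [← inner_delta_left, ← inner_delta_left, adjoint_inner_right, ← inner_conj_symm]
  rfl

/-- The operator `T` sends each basis vector to a basis vector or to zero. -/
def MapsBasis (P : Submonoid G) (T : l2 P →L[ℂ] l2 P) : Prop :=
  ∀ s, T (delta P s) = 0 ∨ ∃ t, T (delta P s) = delta P t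

theorem MapsBasis.one (P : Submonoid G) : MapsBasis P 1 := fun s => Or.inr ⟨s, rfl⟩

theorem MapsBasis.mul {P : Submonoid G} {S T : l2 P →L[ℂ] l2 P}
    (hS : MapsBasis P S) (hT : MapsBasis P T) : MapsBasis P (S * T) := by
  intro s
  rw [mul_apply_eq_comp]
  rcases hT s with h | ⟨t, h⟩
  · simp [h]
  · rw [h]
    exact hS t

theorem MapsBasis.list_prod {P : Submonoid G} {l : List (l2 P →L[ℂ] l2 P)}
    (h : ∀ T ∈ l, MapsBasis P T) : MapsBasis P l.prod := by
  induction l with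
  | nil => exact MapsBasis.one P
  | cons T l ih =>
    rw [List.prod_cons]
    exact (h T List.mem_cons_self).mul (ih fun S hS => h S (List.mem_cons_of_mem T hS))

theorem MapsBasis.adjoint_delta {P : Submonoid G} {T : l2 P →L[ℂ] l2 P}
    (h : MapsBasis P (adjoint T)) {s t : P} (hst : T (delta P s) = delta P t) :
    adjoint T (delta P t) = delta P s := by
  have hval : adjoint T (delta P t) s = 1 := by
    rw [adjoint_delta_apply, hst, delta_apply_self, star_one]
  rcases h t with h0 | ⟨u, hu⟩
  · simp [h0] at hval
  · by_cases hsu : s = u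
    · rw [hu, hsu]
    · simp [hu, delta_apply_of_ne P hsu] at hval

/-- If `T` and `T*` both send basis vectors to basis vectors or zero, then `T` is a partial
isometry. -/
theorem MapsBasis.mul_adjoint_mul {P : Submonoid G} {T : l2 P →L[ℂ] l2 P}
    (hT : MapsBasis P T) (hT' : MapsBasis P (adjoint T)) : T * adjoint T * T = T := by
  refine ext_delta P fun s => ?_
  simp only [mul_apply_eq_comp]
  rcases hT s with h | ⟨t, h⟩
  · simp [h]
  · rw [h, hT'.adjoint_delta h, h]

theorem mapsBasis_adjoint_of_translation {P : Submonoid G} {T : l2 P →L[ℂ] l2 P} {p : P}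
    (hT : ∀ s, T (delta P s) = delta P (p * s)) : MapsBasis P (adjoint T) := by
  intro t
  by_cases ht : ∃ s, p * s = t
  · obtain ⟨s, rfl⟩ := ht
    refine Or.inr ⟨s, lp.ext (funext fun u => ?_)⟩
    rw [adjoint_delta_apply, hT]
    by_cases hus : u = s
    · rw [hus, delta_apply_self, delta_apply_self, star_one]
    · rw [delta_apply_of_ne P hus, delta_apply_of_ne P, star_zero]
      exact fun h => hus (mul_left_cancel h).symm
  · refine Or.inl (lp.ext (funext fun u => ?_))
    rw [adjoint_delta_apply, hT, delta_apply_of_ne P fun h => ht ⟨u, h.symm⟩, star_zero]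
    rfl

theorem mapsBasis_opWord {P : Submonoid G} {V : P → (l2 P →L[ℂ] l2 P)}
    (hV : ∀ p s : P, V p (delta P s) = delta P (p * s)) (l : List (P × P)) :
    MapsBasis P (opWord P V l) := by
  refine MapsBasis.list_prod fun T hT => ?_
  obtain ⟨a, -, rfl⟩ := List.mem_map.1 hT
  exact (mapsBasis_adjoint_of_translation (hV a.1)).mul fun s => Or.inr ⟨_, hV a.2 s⟩

/-- The adjoint of the operator of a word is the operator of the reversed word with each pair
swapped. -/
theorem adjoint_opWord (P : Submonoid G) (V : P → (l2 P →L[ℂ] l2 P)) (l : List (P × P)) :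
    adjoint (opWord P V l) = opWord P V (l.map Prod.swap).reverse := by
  induction l with
  | nil => simp [opWord, ← star_eq_adjoint]
  | cons a l ih =>
    simp only [opWord, ← star_eq_adjoint] at ih ⊢
    simp [ih]

/-- W = V_{p₁}* V_{q₁} ⋯ V_{pₙ}* V_{qₙ} is a partial isometry: W W* W = W. -/
theorem stmt11 (P : Submonoid G)
    (V : P → (l2 P →L[ℂ] l2 P))
    (hV : ∀ p s : P, V p (delta P s) = delta P (p * s))
    (n : ℕ) (p q : Fin n → P) :
    opWord P V (List.ofFn fun i => (p i, q i)) *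
        ContinuousLinearMap.adjoint (opWord P V (List.ofFn fun i => (p i, q i))) *
        opWord P V (List.ofFn fun i => (p i, q i))
      = opWord P V (List.ofFn fun i => (p i, q i)) := by
  refine (mapsBasis_opWord hV _).mul_adjoint_mul ?_
  rw [adjoint_opWord]
  exact mapsBasis_opWord hV _
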